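/- arXiv:1810.03062 — 2 statements merged into one kernel-verified Lean document; each statement's English description precedes it below -/
import Mathlib

section
/- Fix k ≥ 3. Let Δ_k = (ℤ/kℤ) ⋊_φ ℤ (φ sending 1 to inversion) with generating set T_k = {(i,0) : i ≠ 0} ∪ {(i,1) : i ≠ 0,1} ∪ {(i,-1) : i ≠ 0,1}. Then there exists a Borel probability measure μ on F(2^{Δ_k}) such that there is no μ-measurable k-coloring of the shift graph of (Δ_k,T_k); that is, the measure chromatic number of this shift graph equals k+1. -/
open Multiplicative

section Defs

variable {G : Type*} [Group G]

/-- The left shift action of `g : G` on `x : G → Bool` (`2^G` with `2 = Bool`):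
`(g · x)(h) = x (g⁻¹ h)`. -/
def shiftMap (g : G) (x : G → Bool) : G → Bool := fun h => x (g⁻¹ * h)

/-- The free part `F(2^G)` of the left shift action. -/
def FreePart (G : Type*) [Group G] : Set (G → Bool) :=
  {x | ∀ g : G, g ≠ 1 → shiftMap g x ≠ x}

/-- Adjacency in the shift graph of the marked group `(G, S)`: distinct `x, y ∈ F(2^G)`
are adjacent iff `y = s · x` for some `s ∈ S`. -/
def ShiftAdj (S : Set G) (x y : FreePart G) : Prop :=
  x ≠ y ∧ ∃ s ∈ S, (y : G → Bool) = shiftMap s (x : G → Bool)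

/-- Adjacency in the Cayley graph of `(G, S)`: distinct `g, h` are adjacent iff
`h = s * g` for some `s ∈ S`. -/
def CayleyAdj (S : Set G) (g h : G) : Prop :=
  g ≠ h ∧ ∃ s ∈ S, h = s * g

/-- `(G, S)` is a marked group: `S` is a finite symmetric generating set
not containing the identity. -/
def IsMarkedGroup (S : Set G) : Prop :=
  S.Finite ∧ (∀ s ∈ S, s⁻¹ ∈ S) ∧ (1 : G) ∉ S ∧ Subgroup.closure S = ⊤

end Defs

/-- A graph (given by its adjacency relation) has an `n`-coloring. -/
def HasColoring {X : Type*} (Adj : X → X → Prop) (n : ℕ) : Prop :=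
  ∃ c : X → Fin n, ∀ x y, Adj x y → c x ≠ c y

/-- The chromatic number: the least `n` admitting an `n`-coloring. -/
noncomputable def chromatic {X : Type*} (Adj : X → X → Prop) : ℕ :=
  sInf {n | HasColoring Adj n}

/-- A graph on a measurable space has a Borel `n`-coloring. -/
def HasBorelColoring {X : Type*} [MeasurableSpace X] (Adj : X → X → Prop) (n : ℕ) : Prop :=
  ∃ c : X → Fin n, Measurable c ∧ ∀ x y, Adj x y → c x ≠ c y

/-- The Borel chromatic number: the least `n` admitting a Borel `n`-coloring. -/
noncomputable def borelChromatic {X : Type*} [MeasurableSpace X] (Adj : X → X → Prop) : ℕ :=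
  sInf {n | HasBorelColoring Adj n}
open MeasureTheory

/-- The homomorphism `ℤ → Aut(ℤ/kℤ)` (written multiplicatively) sending `1` to the
inversion automorphism `i ↦ -i`. -/
def phiK (k : ℕ) : Multiplicative ℤ →* MulAut (Multiplicative (ZMod k)) :=
  zpowersHom (MulAut (Multiplicative (ZMod k))) (MulEquiv.inv (Multiplicative (ZMod k)))

/-- The marked group `Δ_k = ℤ/kℤ ⋊_φ ℤ`, `φ` sending `1` to inversion. -/
abbrev DeltaK (k : ℕ) : Type :=
  SemidirectProduct (Multiplicative (ZMod k)) (Multiplicative ℤ) (phiK k)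

/-- The generating set
`T_k = {(i,0) : i ≠ 0} ∪ {(i,1) : i ≠ 0,1} ∪ {(i,-1) : i ≠ 0,1}` of `Δ_k`. -/
def TK (k : ℕ) : Set (DeltaK k) :=
  {x | ∃ i : ZMod k, i ≠ 0 ∧ x = ⟨ofAdd i, ofAdd (0 : ℤ)⟩} ∪
  {x | ∃ i : ZMod k, i ≠ 0 ∧ i ≠ 1 ∧ x = ⟨ofAdd i, ofAdd (1 : ℤ)⟩} ∪
  {x | ∃ i : ZMod k, i ≠ 0 ∧ i ≠ 1 ∧ x = ⟨ofAdd i, ofAdd (-1 : ℤ)⟩}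

section General

variable {G : Type*} [Group G]

theorem shiftMap_mul' (g h : G) (x : G → Bool) :
    shiftMap (g * h) x = shiftMap g (shiftMap h x) := by
  funext u; simp [shiftMap, mul_assoc]

theorem shiftMap_one' (x : G → Bool) : shiftMap (1 : G) x = x := by
  funext u; simp [shiftMap]

/-- The shift action on the free part. -/
def act (g : G) (x : FreePart G) : FreePart G :=
  ⟨shiftMap g x.1, by
    intro h hh he
    apply x.2 (g⁻¹ * h * g) (by
      intro h1
      apply hh
      have : h = g * (g⁻¹ * h * g) * g⁻¹ := by group
      rw [this, h1]; group)
    rw [shiftMap_mul', shiftMap_mul', he, ← shiftMap_mul', inv_mul_cancel, shiftMap_one']⟩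

theorem act_mul (g h : G) (x : FreePart G) : act (g * h) x = act g (act h x) :=
  Subtype.ext (shiftMap_mul' g h x.1)

theorem act_one (x : FreePart G) : act (1 : G) x = x :=
  Subtype.ext (shiftMap_one' x.1)

theorem act_ne {g : G} (hg : g ≠ 1) (x : FreePart G) : act g x ≠ x := by
  intro h; exact x.2 g hg (congrArg Subtype.val h)

theorem measurable_act (g : G) : Measurable (act g) := by
  apply Measurable.subtype_mk
  rw [measurable_pi_iff]
  intro h
  exact (measurable_pi_apply (g⁻¹ * h)).comp measurable_subtype_coe

/-- Borel maximal independent sets. -/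
theorem exists_maximal_indep [Countable G] (F : Set G) (hF : F.Finite) (h1 : (1 : G) ∉ F)
    (hs : ∀ g ∈ F, g⁻¹ ∈ F) :
    ∃ B : Set (FreePart G), MeasurableSet B ∧ (∀ x ∈ B, ∀ g ∈ F, act g x ∉ B) ∧
      ∀ x, ∃ g, (g = 1 ∨ g ∈ F) ∧ act g x ∈ B := by
  classical
  have : Finite F := hF
  let A : (F → G × Bool) → Set (FreePart G) := fun u =>
    ⋂ g : F, {x | x.1 (u g).1 = (u g).2 ∧ x.1 (g.1⁻¹ * (u g).1) = !(u g).2}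
  have hA : ∀ u, MeasurableSet (A u) := by
    intro u
    refine MeasurableSet.iInter fun g => ?_
    have m : ∀ h : G, Measurable (fun x : FreePart G => x.1 h) := fun h =>
      (measurable_pi_apply h).comp measurable_subtype_coe
    exact ((m _) (measurableSet_singleton (u g).2)).inter ((m _) (measurableSet_singleton (!(u g).2)))
  have hAc : ∀ x, ∃ u, x ∈ A u := by
    intro x
    have : ∀ g : F, ∃ h : G, x.1 (g.1⁻¹ * h) ≠ x.1 h := by
      intro g
      have := x.2 g.1 (fun h => h1 (h ▸ g.2))
      by_contra hc
      push Not at hc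
      exact this (funext hc)
    choose f hf using this
    refine ⟨fun g => (f g, x.1 (f g)), ?_⟩
    simp only [A, Set.mem_iInter]
    intro g
    refine ⟨rfl, ?_⟩
    have := hf g
    show x.1 (g.1⁻¹ * f g) = !x.1 (f g)
    revert this
    cases x.1 (g.1⁻¹ * f g) <;> cases x.1 (f g) <;> simp
  have hAi : ∀ u x, x ∈ A u → ∀ g ∈ F, act g x ∉ A u := by
    intro u x hx g hg hgx
    simp only [A, Set.mem_iInter] at hx hgx
    have e1 := (hx ⟨g, hg⟩).2
    have e2 := (hgx ⟨g, hg⟩).1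
    simp only [act, shiftMap] at e2
    rw [e1] at e2
    simp at e2
  obtain ⟨e, he⟩ := exists_surjective_nat (F → G × Bool)
  let D : ℕ → Set (FreePart G) := fun n => Nat.rec ∅
    (fun n D => D ∪ (A (e n) \ ⋃ g : F, act g.1 ⁻¹' D)) n
  have D0 : D 0 = ∅ := rfl
  have DS : ∀ n, D (n+1) = D n ∪ (A (e n) \ ⋃ g : F, act g.1 ⁻¹' D n) := fun n => rfl
  clear_value D
  have hD : ∀ n, MeasurableSet (D n) := by
    intro n
    induction n with
    | zero => rw [D0]; exact MeasurableSet.empty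
    | succ n ih =>
      rw [DS]
      exact ih.union ((hA _).diff (MeasurableSet.iUnion fun g => measurable_act g.1 ih))
  have hmono : Monotone D := monotone_nat_of_le_succ fun n => by
    rw [DS]; exact Set.subset_union_left
  have hind : ∀ n, ∀ x ∈ D n, ∀ g ∈ F, act g x ∉ D n := by
    intro n
    induction n with
    | zero => rw [D0]; simp
    | succ n ih =>
      rw [DS]
      rintro x (hx | ⟨hx, hx'⟩) g hg (hy | ⟨hy, hy'⟩)
      · exact ih x hx g hg hy
      · apply hy'
        rw [Set.mem_iUnion]
        refine ⟨⟨g⁻¹, hs g hg⟩, ?_⟩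
        rw [Set.mem_preimage, ← act_mul, inv_mul_cancel, act_one]
        exact hx
      · apply hx'
        rw [Set.mem_iUnion]
        exact ⟨⟨g, hg⟩, hy⟩
      · exact hAi _ x hx g hg hy
  refine ⟨⋃ n, D n, MeasurableSet.iUnion hD, ?_, ?_⟩
  · intro x hx g hg hy
    rw [Set.mem_iUnion] at hx hy
    obtain ⟨n, hn⟩ := hx
    obtain ⟨m, hm⟩ := hy
    exact hind (max n m) x (hmono (le_max_left _ _) hn) g hg (hmono (le_max_right _ _) hm)
  · intro x
    obtain ⟨u, hu⟩ := hAc x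
    obtain ⟨n, rfl⟩ := he u
    by_cases h : x ∈ D (n+1)
    · exact ⟨1, Or.inl rfl, Set.mem_iUnion.2 ⟨n+1, by rwa [act_one]⟩⟩
    · rw [DS] at h
      have : x ∈ ⋃ g : F, act g.1 ⁻¹' D n := by
        by_contra hc
        exact h (Or.inr ⟨hu, hc⟩)
      rw [Set.mem_iUnion] at this
      obtain ⟨g, hg⟩ := this
      exact ⟨g.1, Or.inr g.2, Set.mem_iUnion.2 ⟨n, hg⟩⟩

end General

section Paths

/-- Admissible one-step change of an injective labelling. -/
def LStep {I C : Type*} (e f : I → C) : Prop :=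
  Function.Injective f ∧ ∀ a b, a ≠ b → e a ≠ f b

theorem lstep_update {I C : Type*} [DecidableEq I] {e : I → C} (he : Function.Injective e)
    (b : I) (h : C) (hh : ∀ a, e a ≠ h) : LStep e (Function.update e b h) := by
  constructor
  · intro x y hxy
    by_cases hx : x = b <;> by_cases hy : y = b
    · rw [hx, hy]
    · subst hx; simp [hy] at hxy; exact absurd hxy.symm (hh y)
    · subst hy; simp [hx] at hxy; exact absurd hxy (hh x)
    · simp [hx, hy] at hxy; exact he hxy
  · intro x y hxy
    by_cases hy : y = b
    · subst hy; simpa using hh x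
    · simp [hy]; exact fun h => hxy (he h)

theorem lstep_reach {I C : Type*} [Fintype I] [Fintype C] [DecidableEq I] [DecidableEq C]
    (hc : Fintype.card C = Fintype.card I + 1) (f : I → C) (hf : Function.Injective f) :
    ∀ (n : ℕ) (e : I → C), Function.Injective e →
      (Finset.univ.filter fun i => e i ≠ f i).card = n → Relation.ReflTransGen LStep e f := by
  classical
  -- hole of an injective map
  have hole : ∀ e : I → C, Function.Injective e → ∃ h, (∀ a, e a ≠ h) ∧ 
      ∀ c, c ≠ h → ∃ a, e a = c := by
    intro e he
    have h1 : (Finset.univ \ Finset.univ.image e).card = 1 := by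
      rw [Finset.card_sdiff_of_subset (Finset.subset_univ _), Finset.card_image_of_injective _ he,
        Finset.card_univ, Finset.card_univ, hc]; omega
    obtain ⟨h, hh⟩ := Finset.card_eq_one.1 h1
    have key : ∀ c, (∀ a, e a ≠ c) ↔ c = h := by
      intro c
      have : c ∈ (Finset.univ \ Finset.univ.image e) ↔ c ∈ ({h} : Finset C) := by rw [hh]
      simpa using this
    refine ⟨h, (key h).2 rfl, fun c hch => ?_⟩
    by_contra hcon
    push Not at hcon
    exact hch ((key c).1 hcon)
  intro n
  induction n using Nat.strong_induction_on with
  | _ n ih =>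
  intro e he hn
  obtain ⟨h, hh, hh'⟩ := hole e he
  -- one step in the good case
  have good : ∀ e' : I → C, Function.Injective e' → ∀ b, (∀ a, e' a ≠ f b) →
      (Finset.univ.filter fun i => e' i ≠ f i).card ≤ n → Relation.ReflTransGen LStep e' f := by
    intro e' he' b hb hcard
    have st := lstep_update he' b (f b) hb
    refine Relation.ReflTransGen.head st (ih _ ?_ _ st.1 rfl)
    refine lt_of_lt_of_le (Finset.card_lt_card ?_) hcard
    rw [Finset.ssubset_iff_of_subset]
    · exact ⟨b, by simp [hb b], by simp⟩
    · intro i hi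
      by_cases hib : i = b
      · subst hib; simp at hi
      · simpa [hib] using hi
  by_cases hfh : ∃ b, f b = h
  · obtain ⟨b, rfl⟩ := hfh
    exact good e he b hh hn.le
  · push Not at hfh
    by_cases hef : ∃ b, e b ≠ f b
    · obtain ⟨b, hb⟩ := hef
      obtain ⟨h0, hh0, hh0'⟩ := hole f hf
      have h00 : h0 = h := by
        by_contra hne
        obtain ⟨a, ha⟩ := hh0' h (Ne.symm hne)
        exact hfh a ha
      subst h00
      obtain ⟨b', hb'⟩ := hh0' (e b) (hh b)
      have st := lstep_update he b h0 hh
      refine Relation.ReflTransGen.head st (good _ st.1 b' ?_ ?_)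
      · intro a
        rw [hb']
        by_cases hab : a = b
        · subst hab; simpa using (hh a).symm
        · simp [hab]; exact fun h => hab (he h)
      · rw [← hn]
        apply Finset.card_le_card
        intro i hi
        by_cases hib : i = b
        · subst hib; simpa using hb
        · simpa [hib] using hi
    · push Not at hef
      rw [show e = f from funext hef]

theorem lstep_path {I C : Type*} {e f : I → C} (he : Function.Injective e)
    (h : Relation.ReflTransGen LStep e f) :
    ∃ (l : ℕ) (q : ℕ → I → C), q 0 = e ∧ (∀ n, l ≤ n → q n = f) ∧
      (∀ n, Function.Injective (q n)) ∧ ∀ n, LStep (q n) (q (n+1)) := by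
  induction h using Relation.ReflTransGen.head_induction_on with
  | refl => exact ⟨0, fun _ => f, rfl, fun _ _ => rfl, fun _ => he,
      fun _ => ⟨he, fun a b hab h => hab (he h)⟩⟩
  | @head a c st _ ih =>
    obtain ⟨l, q, q0, ql, qi, qs⟩ := ih st.1
    refine ⟨l+1, fun n => Nat.casesOn n a q, rfl, ?_, ?_, ?_⟩
    · intro n hn
      cases n with
      | zero => omega
      | succ n => exact ql n (by omega)
    · intro n
      cases n with
      | zero => exact he
      | succ n => exact qi n
    · intro n
      cases n with
      | zero => simp only [q0]; exact st
      | succ n => exact qs n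

/-- Uniform interpolation of injective labellings. -/
theorem uniform_paths (I C : Type*) [Fintype I] [Fintype C]
    (hc : Fintype.card C = Fintype.card I + 1) :
    ∃ N : ℕ, ∀ e f : I → C, Function.Injective e → Function.Injective f → ∀ L, N ≤ L →
      ∃ q : ℕ → I → C, q 0 = e ∧ q L = f ∧ (∀ n, Function.Injective (q n)) ∧
        ∀ n a b, a ≠ b → q n a ≠ q (n+1) b := by
  classical
  have : ∀ p : (I → C) × (I → C), ∃ l : ℕ, Function.Injective p.1 → Function.Injective p.2 →
      ∃ q : ℕ → I → C, q 0 = p.1 ∧ (∀ n, l ≤ n → q n = p.2) ∧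
      (∀ n, Function.Injective (q n)) ∧ ∀ n, LStep (q n) (q (n+1)) := by
    rintro ⟨e, f⟩
    by_cases he : Function.Injective e
    · by_cases hf : Function.Injective f
      · obtain ⟨l, q, hq⟩ := lstep_path he (lstep_reach hc f hf _ e he rfl)
        exact ⟨l, fun _ _ => ⟨q, hq⟩⟩
      · exact ⟨0, fun _ h => absurd h hf⟩
    · exact ⟨0, fun h => absurd h he⟩
  choose l hl using this
  refine ⟨Finset.univ.sup l, fun e f he hf L hL => ?_⟩
  obtain ⟨q, q0, ql, qi, qs⟩ := hl (e, f) he hf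
  exact ⟨q, q0, ql L (le_trans (Finset.le_sup (Finset.mem_univ (e, f))) hL), qi,
    fun n a b hab => (qs n).2 a b hab⟩

end Paths
section Delta

variable {k : ℕ}

/-- The element `(i,n)` of `Δ_k`. -/
def el (i : ZMod k) (n : ℤ) : DeltaK k := ⟨ofAdd i, ofAdd n⟩

/-- The height of an element. -/
def ht (g : DeltaK k) : ℤ := toAdd g.right

theorem ht_mul (g h : DeltaK k) : ht (g * h) = ht g + ht h := rfl

theorem ht_inv (g : DeltaK k) : ht g⁻¹ = - ht g := rfl

theorem ht_one : ht (1 : DeltaK k) = 0 := rfl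

@[simp] theorem ht_el (i : ZMod k) (n : ℤ) : ht (el i n) = n := rfl

theorem eq_el (g : DeltaK k) : g = el (toAdd g.left) (ht g) := rfl

theorem el_inj {i j : ZMod k} {n m : ℤ} (h : el i n = el j m) : i = j ∧ n = m :=
  ⟨congrArg (fun g : DeltaK k => toAdd g.left) h, congrArg ht h⟩

theorem el_zero_mul (d i : ZMod k) (n : ℤ) : el d 0 * el i n = el (d + i) n := by
  apply SemidirectProduct.ext
  · simp [el]
  · simp [el]

theorem el_one_mul (d i : ZMod k) (n : ℤ) : el d 1 * el i n = el (d - i) (n + 1) := by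
  apply SemidirectProduct.ext
  · show ofAdd d * (phiK k (ofAdd 1)) (ofAdd i) = ofAdd (d - i)
    have : phiK k (ofAdd 1) = MulEquiv.inv (Multiplicative (ZMod k)) := by simp [phiK]
    rw [this, sub_eq_add_neg]; rfl
  · show ofAdd (1 + n) = ofAdd (n + 1)
    rw [add_comm]

theorem el_zero_one : el (0 : ZMod k) 0 = 1 := rfl

theorem el_zero_inv (d : ZMod k) : (el d 0)⁻¹ = el (-d) 0 := by
  rw [inv_eq_iff_mul_eq_one, el_zero_mul, add_neg_cancel, el_zero_one]

theorem el_negone_mul (d i : ZMod k) (n : ℤ) : el d (-1) * el i n = el (d - i) (n - 1) := by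
  have h : el d 1 * (el d (-1) * el i n) = el i n := by
    rw [← mul_assoc, el_one_mul d d (-1), sub_self]; exact one_mul _
  have h' : el d 1 * el (d - i) (n - 1) = el i n := by rw [el_one_mul]; simp
  exact mul_left_cancel (h.trans h'.symm)

theorem el_one_inv (d : ZMod k) : (el d 1)⁻¹ = el d (-1) := by
  rw [inv_eq_iff_mul_eq_one, el_one_mul, sub_self]; rfl

instance : Countable (DeltaK k) := by
  have : Function.Injective (fun g : DeltaK k => (g.left, g.right)) := by
    intro g h hgh
    simp only [Prod.mk.injEq] at hgh
    exact SemidirectProduct.ext hgh.1 hgh.2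
  have c1 : Countable (ZMod k) := by
    cases k with
    | zero => exact inferInstanceAs (Countable ℤ)
    | succ n => exact inferInstanceAs (Countable (Fin (n+1)))
  have c2 : Countable (Multiplicative (ZMod k)) := c1
  have c3 : Countable (Multiplicative ℤ) := inferInstanceAs (Countable ℤ)
  exact this.countable

/-- The alternating sign. -/
def sg (n : ℕ) (a : ZMod k) : ZMod k := if Even n then a else -a

theorem sg_succ (n : ℕ) (a : ZMod k) : sg (n+1) a = - sg n a := by
  unfold sg
  by_cases h : Even n <;> simp [h, Nat.even_add_one]

theorem sg_sg (n : ℕ) (a : ZMod k) : sg n (sg n a) = a := by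
  unfold sg
  by_cases h : Even n <;> simp [h]

theorem sg_inj (n : ℕ) : Function.Injective (sg n : ZMod k → ZMod k) :=
  Function.LeftInverse.injective (sg_sg n)

theorem sg_add (n : ℕ) (a b : ZMod k) : sg n (a + b) = sg n a + sg n b := by
  unfold sg
  by_cases h : Even n <;> simp [h, add_comm]

theorem layer_paths (k : ℕ) [NeZero k] (std : ZMod k → Fin (k+1)) (hstd : Function.Injective std) :
    ∃ N : ℕ, ∀ (L : ℕ) (j : ZMod k), N ≤ L → ∃ p : ℕ → ZMod k → Fin (k+1),
      p 0 = std ∧ (∀ a, p L (a + j) = std a) ∧ (∀ n, Function.Injective (p n)) ∧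
      ∀ n a b, a + b ≠ 0 → p n a ≠ p (n+1) b := by
  obtain ⟨N, hN⟩ := uniform_paths (ZMod k) (Fin (k+1)) (by simp [ZMod.card])
  refine ⟨N, fun L j hL => ?_⟩
  obtain ⟨q, q0, qL, qi, qs⟩ := hN std (fun b => std (sg L b - j)) hstd
    (fun a b hab => sg_inj L (sub_left_injective (hstd hab))) L hL
  refine ⟨fun n a => q n (sg n a), ?_, ?_, ?_, ?_⟩
  · simp [q0, sg]
  · intro a
    simp [qL, sg_sg]
  · intro n
    exact (qi n).comp (sg_inj n)
  · intro n a b hab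
    apply qs
    rw [sg_succ]
    intro h
    apply hab
    have : sg n (a + b) = sg n 0 := by
      rw [sg_add, h]; simp [sg]
    exact sg_inj n this

theorem exists_borel_coloring (k : ℕ) [NeZero k] :
    ∃ c : FreePart (DeltaK k) → Fin (k+1), Measurable c ∧
      ∀ x y, ShiftAdj (TK k) x y → c x ≠ c y := by
  classical
  obtain ⟨std, hstd⟩ : ∃ std : ZMod k → Fin (k+1), Function.Injective std := by
    have := Function.Embedding.nonempty_of_card_le (α := ZMod k) (β := Fin (k+1))
      (by simp [ZMod.card])
    exact ⟨this.some, this.some.injective⟩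
  obtain ⟨N, hN⟩ := layer_paths k std hstd
  have hN' : ∀ (L : ℕ) (j : ZMod k), ∃ p : ℕ → ZMod k → Fin (k+1), N ≤ L →
      p 0 = std ∧ (∀ a, p L (a + j) = std a) ∧ (∀ n, Function.Injective (p n)) ∧
      ∀ n a b, a + b ≠ 0 → p n a ≠ p (n+1) b := by
    intro L j
    by_cases h : N ≤ L
    · obtain ⟨p, hp⟩ := hN L j h
      exact ⟨p, fun _ => hp⟩
    · exact ⟨fun _ => std, fun h' => absurd h' h⟩
  choose p hp using hN'
  let F : Set (DeltaK k) := {g | g ≠ 1 ∧ |ht g| ≤ N}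
  have hFfin : F.Finite := by
    have : F ⊆ (fun u : ZMod k × ℤ => el u.1 u.2) '' 
        ((Set.univ : Set (ZMod k)) ×ˢ Set.Icc (-(N:ℤ)) N) := by
      rintro g ⟨_, hg⟩
      exact ⟨(toAdd g.left, ht g), ⟨Set.mem_univ _, abs_le.1 hg⟩, rfl⟩
    exact ((Set.finite_univ.prod (Set.finite_Icc _ _)).image _).subset this
  obtain ⟨B, hBm, hBi, hBc⟩ := exists_maximal_indep F hFfin (fun h => h.1 rfl) (by
    rintro g ⟨h1, h2⟩
    refine ⟨inv_ne_one.2 h1, ?_⟩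
    rw [ht_inv, abs_neg]; exact h2)
  have hBi' : ∀ x g, x ∈ B → act g x ∈ B → |ht g| ≤ N → g = 1 := by
    intro x g hx hgx hg
    by_contra hne
    exact hBi x hx g ⟨hne, hg⟩ hgx
  have hBc' : ∀ x, ∃ g : DeltaK k, |ht g| ≤ N ∧ act g x ∈ B := by
    intro x
    obtain ⟨g, hg, hgx⟩ := hBc x
    refine ⟨g, ?_, hgx⟩
    rcases hg with rfl | hg
    · simp [ht_one]
    · exact hg.2
  -- coordinates
  let Q : FreePart (DeltaK k) → ZMod k × ℕ × ZMod k × ℕ → Prop := fun x u =>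
    u.2.1 < u.2.2.2 ∧ act (el u.1 u.2.1)⁻¹ x ∈ B ∧
    act (el u.2.2.1 u.2.2.2 * (el u.1 u.2.1)⁻¹) x ∈ B ∧
    ∀ g : DeltaK k, 0 < ht g → ht g < u.2.2.2 → act (g * (el u.1 u.2.1)⁻¹) x ∉ B
  have Qmeas : ∀ u, MeasurableSet {x | Q x u} := by
    intro u
    simp only [Q]
    refine MeasurableSet.inter (MeasurableSet.const _) (MeasurableSet.inter (measurable_act _ hBm)
      (MeasurableSet.inter (measurable_act _ hBm) ?_))
    have : {x : FreePart (DeltaK k) | ∀ g : DeltaK k, 0 < ht g → ht g < u.2.2.2 →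
        act (g * (el u.1 u.2.1)⁻¹) x ∉ B} = ⋂ g : DeltaK k,
        {x | 0 < ht g → ht g < u.2.2.2 → act (g * (el u.1 u.2.1)⁻¹) x ∉ B} := by
      ext x; simp
    refine MeasurableSet.congr ?_ this.symm
    refine MeasurableSet.iInter fun g => ?_
    by_cases h1 : 0 < ht g <;> by_cases h2 : ht g < u.2.2.2 <;> simp [h1, h2]
    exact measurableSet_setOfPred.1 (measurable_act (g * (el u.1 u.2.1)⁻¹) hBm).compl
  -- next marker
  have next : ∀ b, b ∈ B → ∃ (L : ℕ) (j : ZMod k), 0 < L ∧ act (el j L) b ∈ B ∧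
      ∀ g : DeltaK k, 0 < ht g → ht g < L → act g b ∉ B := by
    intro b hb
    have ex : ∃ L : ℕ, 0 < L ∧ ∃ j : ZMod k, act (el j L) b ∈ B := by
      obtain ⟨g, hg, hgb⟩ := hBc' (act (el 0 (N+1)) b)
      rw [← act_mul] at hgb
      have hh : ht (g * el 0 (N+1)) = ht g + (N+1) := rfl
      rw [abs_le] at hg
      rw [eq_el (g * el 0 (N+1)), hh] at hgb
      refine ⟨(ht g + (N+1)).toNat, by omega, toAdd (g * el 0 (N+1)).left, ?_⟩
      rwa [Int.toNat_of_nonneg (by omega)]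
    obtain ⟨h1, j, hj⟩ := Nat.find_spec ex
    refine ⟨Nat.find ex, j, h1, hj, ?_⟩
    intro g g1 g2 hg
    have := Nat.find_min ex (m := (ht g).toNat) (by omega)
    apply this
    refine ⟨by omega, toAdd g.left, ?_⟩
    rw [Int.toNat_of_nonneg (by omega)]
    exact hg
  have Qtot : ∀ x, ∃ u, Q x u := by
    intro x
    have ex : ∃ n : ℕ, ∃ i : ZMod k, act (el i n)⁻¹ x ∈ B := by
      obtain ⟨g, hg, hgb⟩ := hBc' (act (el 0 N)⁻¹ x)
      rw [← act_mul] at hgb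
      have hh : ht (g * (el 0 N)⁻¹)⁻¹ = N - ht g := by
        rw [ht_inv, ht_mul, ht_inv, ht_el]; ring
      rw [abs_le] at hg
      rw [← inv_inv (g * (el 0 N)⁻¹), eq_el ((g * (el 0 N)⁻¹)⁻¹), hh] at hgb
      refine ⟨(N - ht g).toNat, toAdd ((g * (el 0 N)⁻¹)⁻¹).left, ?_⟩
      rwa [Int.toNat_of_nonneg (by omega)]
    obtain ⟨i, hi⟩ := Nat.find_spec ex
    have hmin := fun m => Nat.find_min ex (m := m)
    generalize Nat.find ex = n at hi hmin
    obtain ⟨L, j, hL, hj, hg⟩ := next _ hi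
    rw [← act_mul] at hj
    refine ⟨(i, n, j, L), ?_, hi, hj, ?_⟩
    · by_contra hlt
      simp only [not_lt] at hlt
      apply hmin (n - L) (by omega)
      have hh : ht (el j L * (el i n)⁻¹)⁻¹ = ((n - L : ℕ) : ℤ) := by
        rw [ht_inv, ht_mul, ht_inv, ht_el, ht_el, Nat.cast_sub hlt]; ring
      rw [← inv_inv (el j L * (el i n)⁻¹), eq_el ((el j L * (el i n)⁻¹)⁻¹), hh] at hj
      exact ⟨_, hj⟩
    · intro g g1 g2
      rw [act_mul]
      exact hg g g1 g2
  have Quniq : ∀ x u v, Q x u → Q x v → u = v := by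
    -- one-sided comparison of the base points
    have le1 : ∀ x u v, Q x u → Q x v → ¬ u.2.1 < v.2.1 := by
      rintro x ⟨i, n, j, L⟩ ⟨i', n', j', L'⟩ ⟨a1, a2, a3, a4⟩ ⟨b1, b2, b3, b4⟩ hlt
      simp only at *
      apply b4 ((el i n)⁻¹ * el i' n')
      · rw [ht_mul, ht_inv, ht_el, ht_el]; omega
      · rw [ht_mul, ht_inv, ht_el, ht_el]; omega
      · rw [mul_inv_cancel_right]; exact a2
    intro x u v hu hv
    have hn := le1 x u v hu hv
    have hn' := le1 x v u hv hu
    obtain ⟨i, n, j, L⟩ := u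
    obtain ⟨i', n', j', L'⟩ := v
    obtain ⟨a1, a2, a3, a4⟩ := hu
    obtain ⟨b1, b2, b3, b4⟩ := hv
    simp only at *
    obtain rfl : n = n' := by omega
    have e1 : (el i' n)⁻¹ * el i n = 1 := by
      apply hBi' (act (el i n)⁻¹ x) _ a2
      · rw [← act_mul, mul_inv_cancel_right]; exact b2
      · rw [ht_mul, ht_inv, ht_el, ht_el]; simp
    obtain rfl : i' = i := (el_inj (inv_mul_eq_one.1 e1)).1
    have hL : ¬ L < L' := fun h => b4 (el j L) (by simp; omega) (by simp; omega) a3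
    have hL' : ¬ L' < L := fun h => a4 (el j' L') (by simp; omega) (by simp; omega) b3
    obtain rfl : L = L' := by omega
    have e2 : el j' L * (el j L)⁻¹ = 1 := by
      apply hBi' _ _ a3
      · rw [← act_mul]
        simpa [mul_assoc] using b3
      · rw [ht_mul, ht_inv, ht_el, ht_el]; simp
    obtain rfl : j' = j := (el_inj (mul_inv_eq_one.1 e2)).1
    rfl
  have QL : ∀ x i n j L, Q x (i, n, j, L) → N ≤ L := by
    rintro x i n j L ⟨a1, a2, a3, a4⟩
    by_contra hlt
    simp only [not_le] at *
    rw [act_mul] at a3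
    have := hBi' _ _ a2 a3 (by simp; omega)
    have := congrArg ht this
    simp [ht_one] at this
    omega
  let col : ZMod k × ℕ × ZMod k × ℕ → Fin (k+1) := fun u => p u.2.2.2 u.2.2.1 u.2.1 u.1
  choose U hU using Qtot
  refine ⟨fun x => col (U x), ?_, ?_⟩
  · have : Measurable[_, ⊤] U := by
      refine @measurable_to_countable' _ _ ⊤ _ _ _ ?_
      intro u
      have : U ⁻¹' {u} = {x | Q x u} := by
        ext x
        constructor
        · intro h
          have h : U x = u := h
          exact h ▸ hU x
        · intro h
          exact Quniq x _ _ (hU x) h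
      rw [this]
      exact Qmeas u
    exact (measurable_from_top (f := col)).comp this
  · have colQ : ∀ x u, Q x u → col (U x) = col u := fun x u h => by rw [Quniq x _ _ (hU x) h]
    have c0 : ∀ x d, d ≠ 0 → col (U x) ≠ col (U (act (el d 0) x)) := by
      intro x d hd
      rcases hu : U x with ⟨i, n, j, L⟩
      have hQ := hU x
      rw [hu] at hQ
      have hQL := QL _ _ _ _ _ hQ
      obtain ⟨a1, a2, a3, a4⟩ := hQ
      have e : (el (d + i) n)⁻¹ * el d 0 = (el i n)⁻¹ := by
        rw [← el_zero_mul]; group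
      rw [colQ (act (el d 0) x) (d + i, n, j, L)]
      · intro h
        have := (hp L j hQL).2.2.1 n h
        simp at this
        exact hd this
      · simp only at *
        refine ⟨a1, ?_, ?_, ?_⟩
        · simp only
          rw [← act_mul, e]; exact a2
        · simp only
          rw [← act_mul, mul_assoc, e]; exact a3
        · intro g g1 g2
          simp only
          rw [← act_mul, mul_assoc, e]; exact a4 g g1 g2
    have c1 : ∀ x d, d ≠ 0 → col (U x) ≠ col (U (act (el d 1) x)) := by
      intro x d hd
      rcases hu : U x with ⟨i, n, j, L⟩
      have hQ := hU x
      rw [hu] at hQ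
      have hQL := QL _ _ _ _ _ hQ
      obtain ⟨a1, a2, a3, a4⟩ := hQ
      simp only at a1 a2 a3 a4
      have e : (el (d - i) (n+1))⁻¹ * el d 1 = (el i n)⁻¹ := by
        rw [← el_one_mul]; group
      have key : col (U (act (el d 1) x)) = p L j (n+1) (d - i) := by
        by_cases hlt : n + 1 < L
        · rw [colQ (act (el d 1) x) (d - i, n+1, j, L)]
          refine ⟨hlt, ?_, ?_, ?_⟩
          · simp only [Nat.cast_add, Nat.cast_one]
            rw [← act_mul, e]; exact a2
          · simp only [Nat.cast_add, Nat.cast_one]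
            rw [← act_mul, mul_assoc, e]; exact a3
          · intro g g1 g2
            simp only [Nat.cast_add, Nat.cast_one]
            rw [← act_mul, mul_assoc, e]; exact a4 g g1 g2
        · obtain rfl : L = n + 1 := by omega
          obtain ⟨L', j', h1, h2, h3⟩ := next _ a3
          have e' : (el (d - i - j) 0)⁻¹ * el d 1 = el j (n+1) * (el i n)⁻¹ := by
            rw [inv_mul_eq_iff_eq_mul, ← mul_assoc, el_zero_mul, eq_mul_inv_iff_mul_eq, el_one_mul]
            simp
          have hQ' : Q (act (el d 1) x) (d - i - j, 0, j', L') := by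
            simp only [Nat.cast_add, Nat.cast_one] at a3 h2 h3
            refine ⟨h1, ?_, ?_, ?_⟩
            · simp only [Nat.cast_zero]
              rw [← act_mul, e']; exact a3
            · simp only [Nat.cast_zero]
              rw [← act_mul, mul_assoc, e', act_mul]; exact h2
            · intro g g1 g2
              simp only [Nat.cast_zero]
              rw [← act_mul, mul_assoc, e', act_mul]; exact h3 g g1 g2
          rw [colQ _ _ hQ']
          show p L' j' 0 (d - i - j) = _
          rw [(hp L' j' (QL _ _ _ _ _ hQ')).1, ← (hp (n+1) j hQL).2.1]
          simp
      rw [key]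
      exact (hp L j hQL).2.2.2 n i (d - i) (by simpa using hd)
    rintro x y ⟨hxy, s, hs, hy⟩
    have hy' : y = act s x := Subtype.ext hy
    rcases hs with (⟨i, hi, rfl⟩ | ⟨i, hi, hi', rfl⟩) | ⟨i, hi, hi', rfl⟩
    · rw [hy']; exact c0 x i hi
    · rw [hy']; exact c1 x i hi
    · have : x = act (el i 1) y := by
        rw [hy', ← act_mul]
        have : el i 1 * el i (-1) = 1 := by rw [← el_one_inv, mul_inv_cancel]
        exact (this ▸ (act_one x)).symm
      have h := c1 y i hi
      rw [← this] at h
      exact h.symm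

end Delta
section Lower

/-- The open arc `(0,1/2)`. -/
def arcU : Set UnitAddCircle := (fun t : ℝ => (t : UnitAddCircle)) '' Set.Ioo 0 (1/2)

/-- The open arc `(1/2,1)`. -/
def arcV : Set UnitAddCircle := (fun t : ℝ => (t : UnitAddCircle)) '' Set.Ioo (1/2) 1

theorem arcU_open : IsOpen arcU := QuotientAddGroup.isOpenMap_coe _ isOpen_Ioo

theorem arcV_open : IsOpen arcV := QuotientAddGroup.isOpenMap_coe _ isOpen_Ioo

theorem arc_disj (u : UnitAddCircle) (h : u ∈ arcU) : u ∉ arcV := by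
  rintro ⟨t, ht, rfl⟩
  obtain ⟨s, hs, hst⟩ := h
  have := (AddCircle.coe_eq_coe_iff_of_mem_Ico (p := (1:ℝ)) (a := 0)
    (x := s) (y := t) ⟨hs.1.le, by linarith [hs.2]⟩ ⟨by linarith [ht.1], by linarith [ht.2]⟩).1 hst
  linarith [hs.2, ht.1]

theorem arc_separate (β : UnitAddCircle) (hβ : β ≠ 0) : ∃ u, u ∈ arcU ∧ u + β ∈ arcV := by
  obtain ⟨r, rfl⟩ := QuotientAddGroup.mk_surjective β
  have hr : ((Int.fract r : ℝ) : UnitAddCircle) = (r : UnitAddCircle) := by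
    rw [Int.fract]
    rw [AddCircle.coe_sub]
    have : ((⌊r⌋ : ℝ) : UnitAddCircle) = 0 := by
      rw [AddCircle.coe_eq_zero_iff]
      exact ⟨⌊r⌋, by simp⟩
    rw [this, sub_zero]
  have h0 := Int.fract_nonneg r
  have h1 := Int.fract_lt_one r
  have hne : Int.fract r ≠ 0 := by
    intro h
    apply hβ
    rw [h] at hr
    exact hr.symm
  generalize Int.fract r = b at *
  have hb : 0 < b := lt_of_le_of_ne h0 (Ne.symm hne)
  obtain ⟨u, hu, hv⟩ : ∃ u : ℝ, u ∈ Set.Ioo (0:ℝ) (1/2) ∧ u + b ∈ Set.Ioo (1/2:ℝ) 1 := by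
    by_cases h : b ≤ 1/2
    · exact ⟨1/2 - b/2, ⟨by linarith, by linarith⟩, ⟨by linarith, by linarith⟩⟩
    · push Not at h
      exact ⟨(1 - b)/2, ⟨by linarith, by linarith⟩, ⟨by linarith, by linarith⟩⟩
  refine ⟨(u : UnitAddCircle), ⟨u, hu, rfl⟩, ⟨u + b, hv, ?_⟩⟩
  show ((u + b : ℝ) : UnitAddCircle) = (u : UnitAddCircle) + (r : UnitAddCircle)
  rw [← hr, AddCircle.coe_add]

theorem exists_irrational_rotation : ∃ α : UnitAddCircle, addOrderOf α = 0 ∧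
    addOrderOf (α + α) = 0 := by
  have h : addOrderOf ((√2 : ℝ) : UnitAddCircle) = 0 := by
    rw [← AddCircle.denseRange_zsmul_iff, AddCircle.denseRange_zsmul_coe_iff]
    simpa using irrational_sqrt_two
  refine ⟨_, h, ?_⟩
  rw [addOrderOf_eq_zero_iff] at *
  intro hc
  apply h
  rw [← two_nsmul] at hc
  exact hc.of_nsmul (by norm_num)

variable {k : ℕ}

open Classical in
/-- The coding of a point of `circle × ℤ/k`. -/
noncomputable def codePt (α : UnitAddCircle) (j : ZMod k) (θ : UnitAddCircle) : DeltaK k → Bool :=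
  fun g => decide (toAdd g.left = j ∧ θ - ht g • α ∈ arcU)

theorem codePt_free {α : UnitAddCircle} (hα : addOrderOf α = 0) (j : ZMod k) (θ : UnitAddCircle) :
    codePt α j θ ∈ FreePart (DeltaK k) := by
  intro g hg he
  have hd : DenseRange (fun n : ℤ => n • α) := AddCircle.denseRange_zsmul_iff.2 hα
  have hd' : ∀ O : Set UnitAddCircle, IsOpen O → O.Nonempty → ∃ n : ℤ, θ - n • α ∈ O := by
    intro O hO hne
    have := hd.exists_mem_open (s := (fun u => θ - u) ⁻¹' O)
      (hO.preimage (by fun_prop)) (by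
        obtain ⟨u, hu⟩ := hne
        exact ⟨θ - u, by simpa using hu⟩)
    exact this
  have key : ∀ n : ℤ, codePt α j θ (g⁻¹ * el j n) = codePt α j θ (el j n) := fun n =>
    congrFun he (el j n)
  have hleft : ∀ n : ℤ, (g⁻¹ * el j n).left = (g⁻¹ * el j 0).left := fun n => rfl
  simp only [codePt, decide_eq_decide, hleft] at key
  have hh : ∀ n : ℤ, ht (g⁻¹ * el j n) = n - ht g := by
    intro n; rw [ht_mul, ht_inv, ht_el]; ring
  simp only [hh, ht_el] at key
  have kj : toAdd (g⁻¹ * el j 0).left = j := by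
    obtain ⟨n, hn⟩ := hd' arcU arcU_open ⟨_, ⟨1/4, ⟨by norm_num, by norm_num⟩, rfl⟩⟩
    exact ((key n).2 ⟨rfl, hn⟩).1
  have key2 : ∀ n : ℤ, θ - n • α ∈ arcU → θ - n • α + ht g • α ∈ arcU := by
    intro n hn
    have := ((key n).2 ⟨rfl, hn⟩).2
    rw [sub_smul] at this
    convert this using 1
    abel
  have hm : ht g = 0 := by
    by_contra hm
    have hβ : ht g • α ≠ 0 := by
      intro h
      rw [addOrderOf_eq_zero_iff] at hα
      exact hα (isOfFinAddOrder_iff_zsmul_eq_zero.2 ⟨ht g, hm, h⟩)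
    obtain ⟨u, hu, hv⟩ := arc_separate _ hβ
    obtain ⟨n, hn1, hn2⟩ := hd' (arcU ∩ (fun u => u + ht g • α) ⁻¹' arcV)
      (arcU_open.inter (arcV_open.preimage (by fun_prop))) ⟨u, hu, hv⟩
    exact arc_disj _ (key2 n hn1) hn2
  apply hg
  have hg' : g⁻¹ = el (toAdd g⁻¹.left) 0 := by
    rw [eq_el g⁻¹, ht_inv, hm]; rfl
  rw [hg', el_zero_mul] at kj
  have : toAdd g⁻¹.left + j = j := kj
  rw [add_eq_right] at this
  rw [this, el_zero_one] at hg'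
  exact inv_eq_one.1 hg'

/-- The coding as a point of the free part. -/
noncomputable def codeF {α : UnitAddCircle} (hα : addOrderOf α = 0) (j : ZMod k)
    (θ : UnitAddCircle) : FreePart (DeltaK k) := ⟨codePt α j θ, codePt_free hα j θ⟩

theorem measurable_codeF {α : UnitAddCircle} (hα : addOrderOf α = 0) (j : ZMod k) :
    Measurable (codeF hα j : UnitAddCircle → FreePart (DeltaK k)) := by
  classical
  apply Measurable.subtype_mk
  rw [measurable_pi_iff]
  intro g
  apply measurable_to_bool
  have : (fun θ => codePt α j θ g) ⁻¹' {true} =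
      {θ | toAdd g.left = j} ∩ (fun θ => θ - ht g • α) ⁻¹' arcU := by
    ext θ; simp [codePt]
  rw [this]
  exact (MeasurableSet.const _).inter (arcU_open.preimage (by fun_prop)).measurableSet

theorem codeF_zero {α : UnitAddCircle} (hα : addOrderOf α = 0) (j d : ZMod k)
    (θ : UnitAddCircle) : (codeF hα (d + j) θ).1 = shiftMap (el d 0) (codeF hα j θ).1 := by
  funext g
  simp only [codeF, shiftMap, codePt]
  rw [el_zero_inv, eq_el g, el_zero_mul]
  simp only [decide_eq_decide]
  show (toAdd g.left = d + j ∧ _) ↔ (-d + toAdd g.left = j ∧ _)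
  rw [neg_add_eq_iff_eq_add]; rfl

theorem codeF_one {α : UnitAddCircle} (hα : addOrderOf α = 0) (j d : ZMod k)
    (θ : UnitAddCircle) : (codeF hα (d - j) (θ + α)).1 = shiftMap (el d 1) (codeF hα j θ).1 := by
  funext g
  simp only [codeF, shiftMap, codePt]
  rw [el_one_inv, eq_el g, el_negone_mul]
  simp only [ht_el]
  refine decide_eq_decide.2 ?_
  show (toAdd g.left = d - j ∧ _) ↔ (d - toAdd g.left = j ∧ _)
  rw [sub_smul, one_smul]
  have e1 : (toAdd g.left = d - j) ↔ (d - toAdd g.left = j) := by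
    constructor <;> intro h
    · rw [h]; abel
    · rw [← h]; abel
  have e2 : θ + α - ht g • α = θ - (ht g • α - α) := by abel
  rw [e1, e2]

/-- Combinatorics of two consecutive layers. -/
theorem layer_step (k : ℕ) [NeZero k] (c c' : ZMod k → Fin k)
    (hc : Function.Injective c) (hc' : Function.Injective c')
    (h : ∀ a b, a + b ≠ 0 → a + b ≠ 1 → c a ≠ c' b) :
    ∃ ε : ZMod k, ∀ b, c' b = c (ε - b) := by
  have hs : Function.Surjective c := by
    have : Function.Bijective c := by
      rw [Fintype.bijective_iff_injective_and_card]
      exact ⟨hc, by simp [ZMod.card]⟩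
    exact this.2
  have h' : ∀ b, c' b = c (-b) ∨ c' b = c (1 - b) := by
    intro b
    obtain ⟨a, ha⟩ := hs (c' b)
    by_cases h0 : a + b = 0
    · left; rw [← ha, eq_neg_of_add_eq_zero_left h0]
    · by_cases h1 : a + b = 1
      · right; rw [← ha, eq_sub_of_add_eq h1]
      · exact absurd ha (h a b h0 h1)
  by_cases hall : ∀ b, c' b = c (-b)
  · exact ⟨0, fun b => by rw [hall b, zero_sub]⟩
  · push Not at hall
    obtain ⟨b0, hb0⟩ := hall
    refine ⟨1, ?_⟩
    have step : ∀ b, c' b = c (1 - b) → c' (b - 1) = c (1 - (b - 1)) := by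
      intro b hb
      rcases h' (b - 1) with h1 | h1
      · have e : c' (b - 1) = c' b := by rw [h1, hb]; congr 1; ring
        have := hc' e
        have h10 : (1 : ZMod k) = 0 := by
          have : b - 1 - b = 0 := by rw [this]; ring
          have h2 : (1 : ZMod k) = -(b - 1 - b) := by ring
          rw [h2, this, neg_zero]
        rw [h1]
        congr 1
        have : -(b-1) = 1 - (b - 1) - 1 := by ring
        rw [this, h10]; ring
      · exact h1
    have all : ∀ n : ℕ, c' (b0 - n) = c (1 - (b0 - n)) := by
      intro n
      induction n with
      | zero =>
        simp only [Nat.cast_zero, sub_zero]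
        exact (h' b0).resolve_left hb0
      | succ n ih =>
        have := step _ ih
        rw [Nat.cast_add, Nat.cast_one, ← sub_sub]
        exact this
    intro b
    have := all (b0 - b).val
    rw [ZMod.natCast_zmod_val] at this
    simpa using this

theorem lower_bound (k : ℕ) (hk : 3 ≤ k) :
    ∃ μ : Measure (FreePart (DeltaK k)), IsProbabilityMeasure μ ∧
      ¬ ∃ c : FreePart (DeltaK k) → Fin k, NullMeasurable c μ ∧
          ∀ x y, ShiftAdj (TK k) x y → c x ≠ c y := by
  have : NeZero k := ⟨by omega⟩
  obtain ⟨α, hα, hα2⟩ := exists_irrational_rotation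
  let ν : ZMod k → Measure (FreePart (DeltaK k)) := fun j => Measure.map (codeF hα j) volume
  have hν : ∀ j, IsProbabilityMeasure (ν j) := fun j =>
    haveI : IsProbabilityMeasure (volume : Measure UnitAddCircle) := ⟨UnitAddCircle.measure_univ⟩
    Measure.isProbabilityMeasure_map (measurable_codeF hα j).aemeasurable
  refine ⟨(k : ENNReal)⁻¹ • Measure.sum ν, ⟨?_⟩, ?_⟩
  · rw [Measure.smul_apply, Measure.sum_apply _ MeasurableSet.univ, tsum_fintype]
    simp only [measure_univ, Finset.sum_const, Finset.card_univ, ZMod.card, smul_eq_mul,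
      nsmul_eq_mul, mul_one]
    exact ENNReal.inv_mul_cancel (by simp; omega) (by simp)
  rintro ⟨c, hcm, hc⟩
  have hm : ∀ j, NullMeasurable (fun θ => c (codeF hα j θ)) volume := by
    intro j
    apply hcm.comp_quasiMeasurePreserving
    refine ⟨measurable_codeF hα j, ?_⟩
    have h1 : ν j ≪ Measure.sum ν := Measure.absolutelyContinuous_sum_right j .rfl
    exact h1.trans (Measure.absolutelyContinuous_smul (by simp))
  have hTne : ∀ s ∈ TK k, s ≠ 1 := by
    rintro s ((⟨i, hi, rfl⟩ | ⟨i, hi, hi', rfl⟩) | ⟨i, hi, hi', rfl⟩) h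
    · exact hi (congrArg (fun g : DeltaK k => toAdd g.left) h)
    · have := congrArg ht h
      simp [ht] at this
    · have := congrArg ht h
      simp [ht] at this
  have hadj : ∀ x y : FreePart (DeltaK k), ∀ s ∈ TK k, y.1 = shiftMap s x.1 → c x ≠ c y := by
    intro x y s hs hxy
    refine hc x y ⟨?_, s, hs, hxy⟩
    intro h
    apply x.2 s (hTne s hs)
    rw [← hxy, h]
  have hinj : ∀ θ, Function.Injective (fun j => c (codeF hα j θ)) := by
    intro θ i j hij
    by_contra hne
    refine hadj _ _ (el (j - i) 0) (Or.inl (Or.inl ⟨j - i, sub_ne_zero.2 (Ne.symm hne), rfl⟩)) ?_ hij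
    rw [← codeF_zero]; simp
  have hstep : ∀ θ, ∃ ε : ZMod k, ∀ b, c (codeF hα b (θ + α)) = c (codeF hα (ε - b) θ) := by
    intro θ
    apply layer_step k (fun j => c (codeF hα j θ)) (fun j => c (codeF hα j (θ + α))) (hinj _) (hinj _)
    intro a b h0 h1
    refine hadj _ _ (el (a + b) 1) (Or.inl (Or.inr ⟨a + b, h0, h1, rfl⟩)) ?_
    rw [← codeF_one]; simp
  let A : Fin k → Fin k → Set UnitAddCircle := fun p q =>
    {θ | ∃ a, c (codeF hα a θ) = p ∧ c (codeF hα (a + 1) θ) = q}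
  have hAm : ∀ p q, NullMeasurableSet (A p q) volume := by
    intro p q
    have : A p q = ⋃ a : ZMod k, ((fun θ => c (codeF hα a θ)) ⁻¹' {p}) ∩
        ((fun θ => c (codeF hα (a+1) θ)) ⁻¹' {q}) := by
      ext θ; simp [A]
    rw [this]
    exact NullMeasurableSet.iUnion fun a =>
      (hm a (measurableSet_singleton p)).inter (hm (a+1) (measurableSet_singleton q))
  have hflip : ∀ p q θ, θ + α ∈ A p q ↔ θ ∈ A q p := by
    intro p q θ
    obtain ⟨ε, hε⟩ := hstep θ
    simp only [A, Set.mem_ofPred_eq, hε]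
    constructor
    · rintro ⟨a, h1, h2⟩
      refine ⟨ε - (a + 1), h2, ?_⟩
      rw [← h1]; congr 2; ring
    · rintro ⟨a, h1, h2⟩
      refine ⟨ε - (a + 1), ?_, ?_⟩
      · rw [← h2]; congr 2; ring
      · rw [← h1]; congr 2; ring
  have hdisj : ∀ p q θ, θ ∈ A p q → θ ∉ A q p := by
    rintro p q θ ⟨a, h1, h2⟩ ⟨b, h3, h4⟩
    have e1 := hinj θ (h1.trans h4.symm)
    have e2 := hinj θ (h2.trans h3.symm)
    rw [e1] at e2
    have h20 : ((2 : ℕ) : ZMod k) = 0 := by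
      have : b + 1 + 1 - b = 0 := by rw [e2]; ring
      have h : ((2 : ℕ) : ZMod k) = b + 1 + 1 - b := by push_cast; ring
      rw [h, this]
    rw [ZMod.natCast_eq_zero_iff] at h20
    have := Nat.le_of_dvd (by norm_num) h20
    omega
  have hmp : ∀ p q, volume (A q p) = volume (A p q) := by
    intro p q
    have h1 : (fun θ => θ + α) ⁻¹' A p q = A q p := by
      ext θ; exact hflip p q θ
    rw [← h1]
    exact (measurePreserving_add_right volume α).measure_preimage (hAm p q)
  have hzero : ∀ p q, volume (A p q) = 0 := by
    intro p q
    have herg : Ergodic (· + (α + α)) (volume : Measure UnitAddCircle) :=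
      AddCircle.ergodic_add_right.2 hα2
    have hinv : (· + (α + α)) ⁻¹' A p q = A p q := by
      ext θ
      show θ + (α + α) ∈ A p q ↔ _
      rw [← add_assoc, hflip, hflip]
    rcases herg.quasiErgodic.ae_empty_or_univ₀ (hAm p q) (Filter.EventuallyEq.of_eq hinv) with h | h
    · exact ae_eq_empty.1 h
    · have h2 : volume (A q p) = 0 := by
        have : A q p ⊆ (A p q)ᶜ := fun θ hθ => hdisj q p θ hθ
        exact measure_mono_null this (ae_eq_univ.1 h)
      rw [← hmp, h2]
  have hall : (Set.univ : Set UnitAddCircle) ⊆ ⋃ p, ⋃ q, A p q := by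
    intro θ _
    simp only [Set.mem_iUnion]
    exact ⟨_, _, 0, rfl, rfl⟩
  have : volume (Set.univ : Set UnitAddCircle) = 0 := by
    refine measure_mono_null hall ?_
    rw [measure_iUnion_null_iff]
    intro p
    rw [measure_iUnion_null_iff]
    exact hzero p
  simp at this

end Lower

/-- For `k ≥ 3` there is a Borel probability measure `μ` on
`F(2^{Δ_k})` admitting no `μ`-measurable `k`-coloring of the shift graph of
`(Δ_k, T_k)`, while every Borel probability measure admits a measurable
`(k+1)`-coloring; that is, the measure chromatic number of this shift graph equals
`k + 1`. -/
theorem measureChromatic_shift_DeltaK (k : ℕ) (hk : 3 ≤ k) :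
    (∃ μ : Measure (FreePart (DeltaK k)), IsProbabilityMeasure μ ∧
      ¬ ∃ c : FreePart (DeltaK k) → Fin k, NullMeasurable c μ ∧
          ∀ x y, ShiftAdj (TK k) x y → c x ≠ c y) ∧
    (∀ μ : Measure (FreePart (DeltaK k)), IsProbabilityMeasure μ →
      ∃ c : FreePart (DeltaK k) → Fin (k + 1), NullMeasurable c μ ∧
        ∀ x y, ShiftAdj (TK k) x y → c x ≠ c y) := by
  have : NeZero k := ⟨by omega⟩
  refine ⟨lower_bound k hk, fun μ _ => ?_⟩
  obtain ⟨c, hcm, hc⟩ := exists_borel_coloring k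
  exact ⟨c, hcm.nullMeasurable, hc⟩
end

section
/- Let (Γ,S) be an infinite marked group whose Cayley graph Cay(Γ,S) is bipartite (admits a 2-coloring). Then the Baire measurable chromatic number of the shift graph of (Γ,S) equals 3: there is a Baire measurable 3-coloring of the shift graph, but no Baire measurable 2-coloring. -/
open Multiplicative

/-- A graph on a topological space has a Baire measurable `n`-coloring: a coloring all
of whose color classes have the Baire property. -/
def HasBaireColoring {X : Type*} [TopologicalSpace X] (Adj : X → X → Prop) (n : ℕ) :
    Prop :=
  ∃ c : X → Fin n, (∀ i : Fin n, BaireMeasurableSet (c ⁻¹' {i})) ∧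
    ∀ x y, Adj x y → c x ≠ c y

/-- The Baire measurable chromatic number. -/
noncomputable def baireChromatic {X : Type*} [TopologicalSpace X]
    (Adj : X → X → Prop) : ℕ :=
  sInf {n | HasBaireColoring Adj n}


namespace ShiftBaire

open Set Filter Topology

set_option linter.unusedSectionVars false

variable {G : Type*} [Group G]

lemma shift_one (x : G → Bool) : shiftMap 1 x = x := by
  funext h; simp [shiftMap]

lemma shift_mul (g h : G) (x : G → Bool) :
    shiftMap (g * h) x = shiftMap g (shiftMap h x) := by
  funext k; simp [shiftMap, mul_assoc]

lemma shift_inv_left (g : G) (x : G → Bool) : shiftMap g⁻¹ (shiftMap g x) = x := by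
  rw [← shift_mul, inv_mul_cancel, shift_one]

lemma shift_inv_right (g : G) (x : G → Bool) : shiftMap g (shiftMap g⁻¹ x) = x := by
  rw [← shift_mul, mul_inv_cancel, shift_one]

lemma shift_continuous (g : G) : Continuous (shiftMap g) := by
  unfold shiftMap; fun_prop

lemma free_inj {x : G → Bool} (hx : x ∈ FreePart G) {g h : G}
    (e : shiftMap g x = shiftMap h x) : g = h := by
  by_contra hne
  refine hx (h⁻¹ * g) (fun h1 => hne ?_) ?_
  · exact (inv_mul_eq_one.1 h1).symm
  · rw [shift_mul, e, shift_inv_left]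

lemma free_shift {x : G → Bool} (hx : x ∈ FreePart G) (g : G) :
    shiftMap g x ∈ FreePart G := by
  intro k hk e
  rw [← shift_mul] at e
  exact hk (by simpa using free_inj hx e)

lemma cyl_of_open {U : Set (G → Bool)} (hU : IsOpen U) {x : G → Bool} (hx : x ∈ U) :
    ∃ D : Finset G, ∀ y : G → Bool, (∀ d ∈ D, y d = x d) → y ∈ U := by
  obtain ⟨D, u, hu, hD⟩ := isOpen_pi_iff.1 hU x hx
  refine ⟨D, fun y hy => hD ?_⟩
  intro d hd
  rw [hy d hd]
  exact (hu d hd).2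

lemma isClopen_cyl (E : Finset G) (y : G → Bool) :
    IsClopen {z : G → Bool | ∀ e ∈ E, z e = y e} := by
  have : {z : G → Bool | ∀ e ∈ E, z e = y e} = ⋂ e ∈ E, (fun z : G → Bool => z e) ⁻¹' {y e} := by
    ext z; simp
  rw [this]
  exact isClopen_biInter_finset fun e _ => (isClopen_discrete _).preimage (continuous_apply e)

lemma isOpen_moved (g : G) : IsOpen {x : G → Bool | shiftMap g x ≠ x} :=
  isOpen_ne_fun (shift_continuous g) continuous_id

lemma dense_moved [Infinite G] {g : G} (hg : g ≠ 1) :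
    Dense {x : G → Bool | shiftMap g x ≠ x} := by
  classical
  rw [dense_iff_inter_open]
  rintro U hU ⟨x, hx⟩
  obtain ⟨D, hD⟩ := cyl_of_open hU hx
  obtain ⟨h, hh⟩ := Infinite.exists_notMem_finset D
  refine ⟨?_, ?_⟩
  · exact Function.update x h (!(if g⁻¹ * h ∈ D then x (g⁻¹ * h) else x (g⁻¹ * h)))
  · constructor
    · apply hD
      intro d hd
      rw [Function.update_of_ne]
      rintro rfl; exact hh hd
    · intro e
      have := congrFun e h
      have hne : g⁻¹ * h ≠ h := by simpa using hg
      simp [shiftMap, Function.update_of_ne hne] at this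

lemma free_eq : FreePart G = ⋂ g : {g : G // g ≠ 1}, {x | shiftMap g.1 x ≠ x} := by
  ext x; simp [FreePart]

lemma free_gdelta [Countable G] : IsGδ (FreePart G) := by
  rw [free_eq]
  exact IsGδ.iInter_of_isOpen fun g => isOpen_moved _

lemma free_dense [Countable G] [Infinite G] : Dense (FreePart G) := by
  rw [free_eq]
  exact dense_iInter_of_isOpen (fun g => isOpen_moved _) fun g => dense_moved g.2

lemma exists_len {S : Set G} (hS : IsMarkedGroup S) (par : G → Bool)
    (hpar : ∀ s ∈ S, ∀ g, par (s * g) = !par g) :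
    ∃ l : G → ℕ, l 1 = 0 ∧ (∀ s ∈ S, ∀ g, l (s * g) ≤ l g + 1) ∧
      (∀ n, {g | l g ≤ n}.Finite) ∧ ∀ g h, l g = l h → par g = par h := by
  classical
  obtain ⟨hfin, hsym, h1, hcl⟩ := hS
  let W : ℕ → Set G := fun n => Nat.rec {1} (fun _ T => Set.image2 (· * ·) S T) n
  have W0 : W 0 = {1} := rfl
  have Ws : ∀ n, W (n + 1) = Set.image2 (· * ·) S (W n) := fun n => rfl
  have Wfin : ∀ n, (W n).Finite := by
    intro n
    induction n with
    | zero => rw [W0]; exact finite_singleton _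
    | succ n ih => rw [Ws]; exact hfin.image2 _ ih
  have ex : ∀ g, ∃ n, g ∈ W n := by
    intro g
    have hg : g ∈ Subgroup.closure S := by rw [hcl]; trivial
    induction hg using Subgroup.closure_induction_left with
    | one => exact ⟨0, rfl⟩
    | mul_left x hx y hy ih =>
      obtain ⟨n, hn⟩ := ih
      exact ⟨n + 1, mem_image2_of_mem hx hn⟩
    | inv_mul_cancel x hx y hy ih =>
      obtain ⟨n, hn⟩ := ih
      exact ⟨n + 1, mem_image2_of_mem (hsym x hx) hn⟩
  have Wpar : ∀ n g h, g ∈ W n → h ∈ W n → par g = par h := by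
    intro n
    induction n with
    | zero =>
      intro g h hg hh
      rw [W0] at hg hh
      rw [mem_singleton_iff.1 hg, mem_singleton_iff.1 hh]
    | succ n ih =>
      rintro g h hg hh
      rw [Ws] at hg hh
      obtain ⟨s, hs, a, ha, rfl⟩ := hg
      obtain ⟨t, ht, b, hb, rfl⟩ := hh
      simp only [hpar s hs, hpar t ht, ih a b ha hb]
  clear_value W
  refine ⟨fun g : G => Nat.find (ex g), ?_, ?_, ?_, ?_⟩
  · exact (Nat.find_eq_zero (ex 1)).2 (by rw [W0]; rfl)
  · intro s hs g
    refine Nat.find_min' (ex (s * g)) ?_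
    rw [Ws]
    exact mem_image2_of_mem hs (Nat.find_spec (ex g))
  · intro n
    refine ((finite_Iic n).biUnion fun i _ => Wfin i).subset ?_
    intro g hg
    exact mem_biUnion (show Nat.find (ex g) ∈ Iic n from hg) (Nat.find_spec (ex g))
  · intro g h e
    have e' : Nat.find (ex g) = Nat.find (ex h) := e
    refine Wpar (Nat.find (ex g)) g h (Nat.find_spec (ex g)) ?_
    rw [e']; exact Nat.find_spec (ex h)

/-- Two-colorings of the shift graph flip along odd elements. -/
lemma color_parity {S : Set G} (hS : IsMarkedGroup S) (par : G → Bool) (h1 : par 1 = false)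
    (hpar : ∀ s ∈ S, ∀ g, par (s * g) = !par g)
    (c : FreePart G → Fin 2) (hc : ∀ x y, ShiftAdj S x y → c x ≠ c y)
    (g : G) (x : FreePart G) :
    c ⟨shiftMap g x, free_shift x.2 g⟩ = c x ↔ par g = false := by
  obtain ⟨hfin, hsym, hs1, hcl⟩ := hS
  have key : ∀ s ∈ S, ∀ g, (c ⟨shiftMap g x, free_shift x.2 g⟩ = c x ↔ par g = false) →
      (c ⟨shiftMap (s * g) x, free_shift x.2 _⟩ = c x ↔ par (s * g) = false) := by
    intro s hs g ih
    have hne := hc ⟨shiftMap g x, free_shift x.2 g⟩ ⟨shiftMap (s * g) x, free_shift x.2 _⟩ (by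
      refine ⟨fun e => hs1 ?_, s, hs, shift_mul _ _ _⟩
      have := free_inj x.2 (Subtype.ext_iff.1 e)
      have h1 : s = 1 := by simpa using this
      exact h1 ▸ hs)
    rw [hpar s hs]
    have : (c ⟨shiftMap (s * g) x, free_shift x.2 _⟩ = c x ↔
      ¬ c ⟨shiftMap g x, free_shift x.2 g⟩ = c x) := by omega
    rw [this, ih]; simp
  have hg : g ∈ Subgroup.closure S := by rw [hcl]; trivial
  induction hg using Subgroup.closure_induction_left with
  | one => simp [shift_one, h1]
  | mul_left s hs y hy ih => exact key s hs y ih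
  | inv_mul_cancel s hs y hy ih => exact key _ (hsym s hs) y ih

lemma no_two [Countable G] [Infinite G] {S : Set G} (hS : IsMarkedGroup S) (par : G → Bool)
    (h1 : par 1 = false) (hpar : ∀ s ∈ S, ∀ g, par (s * g) = !par g) :
    ¬ HasBaireColoring (ShiftAdj S) 2 := by
  classical
  rintro ⟨c, hcm, hc⟩
  have hB : BaireSpace (FreePart G) := free_gdelta.baireSpace_of_dense free_dense
  have hne : Nonempty (FreePart G) := (free_dense (G := G)).nonempty.to_subtype
  choose O hO hOe using fun i => (hcm i).residualEq_isOpen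
  have hOe' : ∀ i, ∀ᶠ x in residual (FreePart G), (c x = i ↔ x ∈ O i) := by
    intro i
    filter_upwards [eventuallyEq_set.1 (hOe i)] with x hx
    exact hx
  obtain ⟨x0, hx0⟩ := (dense_of_mem_residual ((hOe' 0).and (hOe' 1))).nonempty
  obtain ⟨i, hi⟩ : ∃ i, (O i).Nonempty := by
    have : c x0 = 0 ∨ c x0 = 1 := by omega
    rcases this with h | h
    · exact ⟨0, x0, hx0.1.1 h⟩
    · exact ⟨1, x0, hx0.2.1 h⟩
  obtain ⟨x, hx⟩ := hi
  obtain ⟨V, hV, hVO⟩ := isOpen_induced_iff.1 (hO i)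
  have hxV : x.1 ∈ V := by rw [← hVO] at hx; exact hx
  obtain ⟨D, hD⟩ := cyl_of_open hV hxV
  -- an odd element moving `D` off itself
  obtain ⟨g, hgp, hgD⟩ : ∃ g, par g = true ∧ ∀ d ∈ D, g * d ∉ D := by
    have hSne : S.Nonempty := by
      rw [nonempty_iff_ne_empty]
      rintro rfl
      have := hS.2.2.2
      rw [Subgroup.closure_empty] at this
      have hsub : Subsingleton G := (Subgroup.subsingleton_iff).1 ⟨fun a b => by
        have := subsingleton_of_bot_eq_top this
        exact Subsingleton.elim a b⟩
      exact not_finite G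
    obtain ⟨s, hs⟩ := hSne
    have hinf : {g | par g = true}.Infinite := by
      intro hf
      have h2 : {g | par g = false}.Finite := by
        refine (hf.image (fun g => s⁻¹ * g)).subset ?_
        intro g hg
        refine ⟨s * g, ?_, by simp⟩
        change par (s * g) = true
        rw [hpar s hs, show par g = false from hg]; rfl
      refine (Set.infinite_univ (α := G)) ((hf.union h2).subset ?_)
      intro g _
      cases h : par g <;> simp [h]
    have hfin : (Set.image2 (fun a b : G => a * b⁻¹) D D).Finite :=
      D.finite_toSet.image2 _ D.finite_toSet
    obtain ⟨g, hg, hg'⟩ := hinf.exists_notMem_finite hfin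
    refine ⟨g, hg, fun d hd hgd => hg' ⟨g * d, hgd, d, hd, by simp⟩⟩
  let T : FreePart G → FreePart G := fun y => ⟨shiftMap g y, free_shift y.2 g⟩
  have hT : Continuous T := by
    refine Continuous.subtype_mk ?_ _
    exact (shift_continuous g).comp continuous_subtype_val
  have hT' : Continuous (fun y : FreePart G => (⟨shiftMap g⁻¹ y, free_shift y.2 _⟩ : FreePart G)) := by
    refine Continuous.subtype_mk ?_ _
    exact (shift_continuous g⁻¹).comp continuous_subtype_val
  let H : FreePart G ≃ₜ FreePart G :=
    { toFun := T
      invFun := fun y => ⟨shiftMap g⁻¹ y, free_shift y.2 _⟩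
      left_inv := fun y => Subtype.ext (shift_inv_left g y)
      right_inv := fun y => Subtype.ext (shift_inv_right g y)
      continuous_toFun := hT
      continuous_invFun := hT' }
  have hTo : ∀ᶠ y in residual (FreePart G), (c (T y) = i ↔ T y ∈ O i) :=
    (tendsto_residual_of_isOpenMap H.continuous H.isOpenMap).eventually (hOe' i)
  have hW : IsOpen (V ∩ shiftMap g ⁻¹' V) := hV.inter (hV.preimage (shift_continuous g))
  have hWne : (V ∩ shiftMap g ⁻¹' V).Nonempty := by
    refine ⟨fun k => if k ∈ D then x.1 k else x.1 (g * k), ?_, ?_⟩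
    · apply hD
      intro d hd
      simp [hd]
    · apply hD
      intro d hd
      have : g⁻¹ * d ∉ D := by
        intro h
        exact hgD _ h (by simpa using hd)
      simp [shiftMap, this]
  obtain ⟨z, hz, hzF⟩ := free_dense.inter_open_nonempty _ hW hWne
  have hW' : IsOpen ((↑) ⁻¹' (V ∩ shiftMap g ⁻¹' V) : Set (FreePart G)) :=
    hW.preimage continuous_subtype_val
  obtain ⟨y, hy, hy1, hy2⟩ := (dense_of_mem_residual ((hOe' i).and hTo)).inter_open_nonempty _ hW'
    ⟨⟨z, hzF⟩, hz⟩
  have e1 : c y = i := hy1.2 (by rw [← hVO]; exact hy.1)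
  have e2 : c (T y) = i := hy2.2 (by rw [← hVO]; exact hy.2)
  have := (color_parity hS par h1 hpar c hc g y).1 (e2.trans e1.symm)
  simp [hgp] at this

end ShiftBaire

namespace ShiftBaire

open Set Filter Topology

/-- A clopen set of centers with a radius: translates by short elements are disjoint. -/
def Good {G : Type*} [Group G] (l : G → ℕ) (p : Set (G → Bool) × ℕ) : Prop :=
  IsClopen p.1 ∧ (fun _ => false) ∉ p.1 ∧
    ∀ g g' c c', l g ≤ p.2 + 2 → l g' ≤ p.2 + 2 → c ∈ p.1 → c' ∈ p.1 →
      shiftMap g c = shiftMap g' c' → g = g'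

/-- The spheres around the centers of `q` are not adjacent to those around the centers of `p`. -/
def Compat {G : Type*} [Group G] (S : Set G) (l : G → ℕ) (p q : Set (G → Bool) × ℕ) : Prop :=
  ∀ g s h, l g = q.2 + 1 → s ∈ S → l h = p.2 + 1 → ∀ c ∈ p.1, ∀ c' ∈ q.1,
    shiftMap (s * g) c' ≠ shiftMap h c

lemma exists_seq_rec {α : Type*} (P : α → Prop) (Q : ℕ → α → Prop) (R : α → α → Prop)
    (h : ∀ (n : ℕ) (t : Finset α), (∀ x ∈ t, P x) → ∃ y, P y ∧ Q n y ∧ ∀ x ∈ t, R x y) :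
    ∃ f : ℕ → α, (∀ n, P (f n) ∧ Q n (f n)) ∧ ∀ m n, m < n → R (f m) (f n) := by
  classical
  choose F hF using h
  have hne : Nonempty {x // P x} := ⟨⟨F 0 ∅ (by simp), (hF 0 ∅ (by simp)).1⟩⟩
  -- sequence of finite sets of good elements
  let step : ℕ → Finset {x // P x} → {x // P x} := fun n t =>
    ⟨F n (t.image Subtype.val) (by
      intro x hx
      obtain ⟨y, _, rfl⟩ := Finset.mem_image.1 hx
      exact y.2), (hF n _ _).1⟩
  have hstepQ : ∀ n t, Q n (step n t) := fun n t => (hF n _ _).2.1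
  have hstepR : ∀ n t, ∀ x ∈ t, R x.1 (step n t) := fun n t x hx =>
    (hF n _ _).2.2 _ (Finset.mem_image_of_mem _ hx)
  let A : ℕ → Finset {x // P x} := fun n => Nat.rec ∅ (fun n t => insert (step n t) t) n
  have As : ∀ n, A (n + 1) = insert (step n (A n)) (A n) := fun n => rfl
  have mono : Monotone A := monotone_nat_of_le_succ fun n => by
    rw [As]; exact Finset.subset_insert _ _
  refine ⟨fun n => (step n (A n)).1, fun n => ⟨(step n (A n)).2, hstepQ _ _⟩, ?_⟩
  intro m n hmn
  refine hstepR n (A n) _ (mono (Nat.succ_le_of_lt hmn) ?_)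
  change _ ∈ A (m + 1)
  rw [As]; exact Finset.mem_insert_self _ _

variable {G : Type*} [Group G]

lemma bad_finite (D : Finset G) (x : G → Bool) (hx : ∀ d, d ∉ D → x d = false)
    {C : Set (G → Bool)} (hC : IsClosed C) (h0 : (fun _ => false) ∉ C) :
    {g : G | shiftMap g x ∈ C}.Finite := by
  obtain ⟨E, hE⟩ := cyl_of_open hC.isOpen_compl h0
  refine (E.finite_toSet.image2 (fun e d => e * d⁻¹) D.finite_toSet).subset ?_
  intro g hg
  by_contra hcon
  refine hE (shiftMap g x) ?_ hg
  intro e he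
  apply hx
  intro hd
  exact hcon ⟨e, he, g⁻¹ * e, hd, by simp⟩

lemma step [Countable G] [Infinite G] {S : Set G} (hfin : S.Finite) (l : G → ℕ)
    (hl : ∀ n, {g | l g ≤ n}.Finite) {U : Set (G → Bool)} (hU : IsOpen U) (hUne : U.Nonempty)
    (t : Finset (Set (G → Bool) × ℕ)) (ht : ∀ p ∈ t, Good l p) :
    ∃ q, Good l q ∧ (q.1.Nonempty ∧ q.1 ⊆ U) ∧ ∀ p ∈ t, Compat S l p q := by
  classical
  obtain ⟨x0, hx0⟩ := hUne
  obtain ⟨D, hD⟩ := cyl_of_open hU hx0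
  let x : G → Bool := fun d => if d ∈ D then x0 d else false
  have hxU : x ∈ U := hD x fun d hd => by simp [x, hd]
  have hxD : ∀ d, d ∉ D → x d = false := fun d hd => by simp [x, hd]
  have hl' : ∀ n, {g | l g = n}.Finite := fun n => (hl n).subset fun g hg => le_of_eq hg
  have hbad : (⋃ p ∈ t, Set.image2 (fun (a : G × G) b => a.1⁻¹ * a.2 * b)
      (S ×ˢ {h | l h = p.2 + 1}) {g | shiftMap g x ∈ p.1}).Finite := by
    refine t.finite_toSet.biUnion fun p hp => ?_
    exact (hfin.prod (hl' _)).image2 _ (bad_finite D x hxD (ht p hp).1.1 (ht p hp).2.1)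
  obtain ⟨N, hN⟩ := (hbad.image l).bddAbove
  have hNx : ∀ p ∈ t, ∀ g s h, l g = N + 1 → s ∈ S → l h = p.2 + 1 →
      shiftMap (h⁻¹ * (s * g)) x ∉ p.1 := by
    intro p hp g s h hg hs hh hmem
    have : l g ≤ N := by
      apply hN
      refine mem_image_of_mem _ (mem_biUnion (Finset.mem_coe.2 hp) ?_)
      exact ⟨(s, h), ⟨hs, hh⟩, _, hmem, by simp [mul_assoc]⟩
    omega
  let V : Set (G → Bool) := U ∩ ⋂ p ∈ t, ⋂ a ∈ ({g | l g = N + 1} ×ˢ S) ×ˢ {h | l h = p.2 + 1},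
    shiftMap (a.2⁻¹ * (a.1.2 * a.1.1)) ⁻¹' (p.1)ᶜ
  have hV : IsOpen V := by
    refine hU.inter (t.finite_toSet.isOpen_biInter fun p hp => ?_)
    refine (((hl' _).prod hfin).prod (hl' _)).isOpen_biInter fun a _ => ?_
    exact (ht p hp).1.1.isOpen_compl.preimage (shift_continuous _)
  have hxV : x ∈ V := by
    refine ⟨hxU, ?_⟩
    simp only [mem_iInter]
    rintro p hp ⟨⟨g, s⟩, h⟩ ⟨⟨hg, hs⟩, hh⟩
    exact hNx p hp g s h hg hs hh
  obtain ⟨y, hyV, hyF⟩ := free_dense.inter_open_nonempty V hV ⟨x, hxV⟩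
  obtain ⟨E, hE⟩ := cyl_of_open hV hyV
  have hcoord : ∀ k : G, ∃ e, k ≠ 1 → shiftMap k y e ≠ y e := by
    intro k
    by_cases hk : k = 1
    · exact ⟨1, fun h => absurd hk h⟩
    · obtain ⟨e, he⟩ := Function.ne_iff.1 (hyF k hk)
      exact ⟨e, fun _ => he⟩
  choose e he using hcoord
  obtain ⟨k0, hk0⟩ := exists_ne (1 : G)
  have hy0 : ∃ d, y d ≠ false := by
    by_contra hcon
    push Not at hcon
    apply he k0 hk0
    simp [shiftMap, hcon]
  obtain ⟨d0, hd0⟩ := hy0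
  let K : Finset G := ((hl (N + 2)).image2 (fun a b : G => a⁻¹ * b) (hl (N + 2))).toFinset
  let E' : Finset G := insert d0 (E ∪ (K.image e ∪ K.image fun k => k⁻¹ * e k))
  refine ⟨({z | ∀ d ∈ E', z d = y d}, N), ⟨isClopen_cyl _ _, ?_, ?_⟩, ⟨⟨y, fun d _ => rfl⟩, ?_⟩, ?_⟩
  · intro h
    exact hd0 (h d0 (by simp [E'])).symm
  · intro g g' c c' hg hg' hc hc' heq
    by_contra hne
    have hk : g'⁻¹ * g ∈ K := by
      simp only [K, Set.Finite.mem_toFinset]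
      exact ⟨g', hg', g, hg, rfl⟩
    have hk1 : g'⁻¹ * g ≠ 1 := fun h => hne (inv_mul_eq_one.1 h).symm
    have heq' : shiftMap (g'⁻¹ * g) c = c' := by rw [shift_mul, heq, shift_inv_left]
    apply he _ hk1
    have h1 := hc ((g'⁻¹ * g)⁻¹ * e (g'⁻¹ * g)) (by
      simp only [E', Finset.mem_insert, Finset.mem_union]
      exact Or.inr (Or.inr (Or.inr (Finset.mem_image_of_mem (fun k => k⁻¹ * e k) hk))))
    have h2 := hc' (e (g'⁻¹ * g)) (by
      simp only [E', Finset.mem_insert, Finset.mem_union]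
      exact Or.inr (Or.inr (Or.inl (Finset.mem_image_of_mem _ hk))))
    rw [← h2, ← heq']
    simp only [shiftMap]
    exact h1.symm
  · intro z hz
    exact (hE z fun d hd => hz d (by simp [E', hd])).1
  · intro p hp g s h hg hs hh c hc c' hc' heq
    have hc'V : c' ∈ V := hE c' fun d hd => hc' d (by simp [E', hd])
    have h2 := hc'V.2
    simp only [mem_iInter] at h2
    refine h2 p hp ((g, s), h) ⟨⟨hg, hs⟩, hh⟩ ?_
    change shiftMap (h⁻¹ * (s * g)) c' ∈ p.1
    rw [shift_mul, heq, shift_inv_left]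
    exact hc

/-- A (non-definable) two-coloring of the shift graph. -/
lemma exists_two {S : Set G} (par : G → Bool) (hpar : ∀ s ∈ S, ∀ g, par (s * g) = !par g) :
    ∃ f : FreePart G → Bool, ∀ (x y : FreePart G), ∀ s ∈ S, (y : G → Bool) = shiftMap s x →
      f y = !f x := by
  classical
  let st : Setoid (FreePart G) :=
    { r := fun x y => ∃ g, (y : G → Bool) = shiftMap g x
      iseqv := by
        refine ⟨fun x => ⟨1, (shift_one _).symm⟩, ?_, ?_⟩
        · rintro x y ⟨g, hg⟩
          exact ⟨g⁻¹, by rw [hg, shift_inv_left]⟩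
        · rintro x y z ⟨g, hg⟩ ⟨h, hh⟩
          exact ⟨h * g, by rw [hh, hg, shift_mul]⟩ }
  have hrep : ∀ x : FreePart G, ∃ g, (x : G → Bool) = shiftMap g (Quotient.mk st x).out := by
    intro x
    exact Quotient.mk_out (s := st) x
  choose k hk using hrep
  refine ⟨fun x => par (k x), fun x y s hs hxy => ?_⟩
  have hq : Quotient.mk st x = Quotient.mk st y := Quotient.sound ⟨s, hxy⟩
  have : k y = s * k x := by
    apply free_inj (Quotient.mk st x).out.2
    rw [shift_mul, ← hk x, ← hxy]
    rw [hq]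
    exact (hk y).symm
  simp only [this, hpar s hs]

lemma three [Countable G] [Infinite G] {S : Set G} (hS : IsMarkedGroup S) (par : G → Bool)
    (hpar : ∀ s ∈ S, ∀ g, par (s * g) = !par g) : HasBaireColoring (ShiftAdj S) 3 := by
  classical
  obtain ⟨l, l1, ls, hl, lpar⟩ := exists_len hS par hpar
  obtain ⟨b, hbc, hbe, hb⟩ := TopologicalSpace.exists_countable_basis (G → Bool)
  have hbne : b.Nonempty := by
    obtain ⟨u, hu, -⟩ := hb.exists_subset_of_mem_open (mem_univ (fun _ : G => false)) isOpen_univ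
    exact ⟨u, hu⟩
  obtain ⟨U, rfl⟩ := hbc.exists_eq_range hbne
  have hUo : ∀ n, IsOpen (U n) := fun n => hb.isOpen ⟨n, rfl⟩
  have hUne : ∀ n, (U n).Nonempty := by
    intro n
    rw [nonempty_iff_ne_empty]
    intro h
    exact hbe ⟨n, h⟩
  obtain ⟨p, hp, hcomp⟩ := exists_seq_rec (Good l)
    (fun n q => q.1.Nonempty ∧ q.1 ⊆ U n) (Compat S l)
    (fun n t ht => step hS.1 l hl (hUo n) (hUne n) t ht)
  obtain ⟨f, hf⟩ := exists_two par hpar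
  -- the separating set, and the pieces
  let I : FreePart G → Prop := fun x => ∃ n g, l g = (p n).2 + 1 ∧ shiftMap g⁻¹ x ∈ (p n).1
  let Q : ℕ → FreePart G → Bool → Prop := fun n x i =>
    ∃ g, l g ≤ (p n).2 ∧ shiftMap g⁻¹ x ∈ (p n).1 ∧ par g = i
  let emb : Bool → Fin 3 := fun i => if i then 1 else 0
  have emb_inj : Function.Injective emb := by decide
  have emb_ne : ∀ i, emb i ≠ 2 := by decide
  have Quniq : ∀ n x i j, Q n x i → Q n x j → i = j := by
    rintro n x i j ⟨g, hg, hgx, rfl⟩ ⟨h, hh, hhx, rfl⟩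
    rw [(hp n).1.2.2 g h _ _ (by omega) (by omega) hgx hhx
      (by rw [shift_inv_right, shift_inv_right])]
  have hcol : ∃ col : FreePart G → Fin 3, (∀ x, I x → col x = 2) ∧
      (∀ x, ¬ I x → ∀ n i, Q n x i → (∀ m < n, ∀ j, ¬ Q m x j) → col x = emb i) ∧
      (∀ x, ¬ I x → (∀ n i, ¬ Q n x i) → col x = emb (f x)) := by
    have : ∀ x, ∃ a : Fin 3, (I x → a = 2) ∧
      (¬ I x → ∀ n i, Q n x i → (∀ m < n, ∀ j, ¬ Q m x j) → a = emb i) ∧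
      (¬ I x → (∀ n i, ¬ Q n x i) → a = emb (f x)) := by
      intro x
      by_cases hI : I x
      · exact ⟨2, fun _ => rfl, fun h => absurd hI h, fun h => absurd hI h⟩
      by_cases hQ : ∃ n i, Q n x i
      · obtain ⟨i, hi⟩ := Nat.find_spec hQ
        refine ⟨emb i, fun h => absurd h hI, fun _ n j hj hmin => ?_, fun _ h => ?_⟩
        · have hn : Nat.find hQ = n := by
            apply le_antisymm
            · exact Nat.find_min' hQ ⟨j, hj⟩
            · by_contra hlt
              exact hmin _ (not_le.1 hlt) i hi
          rw [hn] at hi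
          rw [Quniq n x i j hi hj]
        · exact absurd hi (h _ _)
      · push Not at hQ
        exact ⟨emb (f x), fun h => absurd h hI, fun _ n i h => absurd h (hQ n i), fun _ _ => rfl⟩
    choose col h using this
    exact ⟨col, fun x => (h x).1, fun x => (h x).2.1, fun x => (h x).2.2⟩
  obtain ⟨col, hcolI, hcolQ, hcolZ⟩ := hcol
  -- topology
  have hopen : ∀ n g, IsOpen {x : FreePart G | shiftMap g⁻¹ x ∈ (p n).1} := fun n g =>
    (hp n).1.1.2.preimage ((shift_continuous g⁻¹).comp continuous_subtype_val)
  have hIopen : IsOpen {x | I x} := by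
    have : {x | I x} = ⋃ n, ⋃ g, ⋃ (_ : l g = (p n).2 + 1),
        {x : FreePart G | shiftMap g⁻¹ x ∈ (p n).1} := by
      ext x; simp [I]
    rw [this]
    exact isOpen_iUnion fun n => isOpen_iUnion fun g => isOpen_iUnion fun _ => hopen n g
  have hQo : ∀ n i, IsOpen {x | Q n x i} := by
    intro n i
    have : {x | Q n x i} = ⋃ g, ⋃ (_ : l g ≤ (p n).2 ∧ par g = i),
        {x : FreePart G | shiftMap g⁻¹ x ∈ (p n).1} := by
      ext x
      simp only [Q, mem_iUnion, mem_ofPred_eq]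
      constructor
      · rintro ⟨g, h1, h2, h3⟩; exact ⟨g, ⟨h1, h3⟩, h2⟩
      · rintro ⟨g, ⟨h1, h3⟩, h2⟩; exact ⟨g, h1, h2, h3⟩
    rw [this]
    exact isOpen_iUnion fun g => isOpen_iUnion fun _ => hopen n g
  have hcov : {x | ∃ n i, Q n x i} ∈ residual (FreePart G) := by
    apply residual_of_dense_open
    · have : {x | ∃ n i, Q n x i} = ⋃ n, ⋃ i, {x | Q n x i} := by ext x; simp
      rw [this]
      exact isOpen_iUnion fun n => isOpen_iUnion fun i => hQo n i
    · rw [dense_iff_inter_open]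
      rintro W hW ⟨w, hw⟩
      obtain ⟨V, hV, rfl⟩ := isOpen_induced_iff.1 hW
      obtain ⟨_, ⟨n, rfl⟩, hwn, hnV⟩ := hb.exists_subset_of_mem_open hw hV
      obtain ⟨z, hz, hzF⟩ := free_dense.inter_open_nonempty _ (hp n).1.1.2 (hp n).2.1
      refine ⟨⟨z, hzF⟩, hnV ((hp n).2.2 hz), n, par 1, 1, by omega, ?_, rfl⟩
      simpa [shift_one] using hz
  refine ⟨col, ?_, ?_⟩
  · have h2 : BaireMeasurableSet (col ⁻¹' {2}) := by
      refine hIopen.baireMeasurableSet.congr (eventuallyEq_set.2 ?_)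
      filter_upwards [hcov] with x hx
      refine ⟨hcolI x, fun h => ?_⟩
      by_contra hI
      have hI' : ¬ I x := hI
      by_cases hQ : ∃ n i, Q n x i
      · obtain ⟨i, hi⟩ := Nat.find_spec hQ
        have := hcolQ x hI' _ i hi (fun m hm j hj => Nat.find_min hQ hm ⟨j, hj⟩)
        exact emb_ne i (this.symm.trans h)
      · exact hQ hx
    have hi : ∀ i, BaireMeasurableSet (col ⁻¹' {emb i}) := by
      intro i
      have hB : BaireMeasurableSet ({x | I x}ᶜ ∩
          ⋃ n, ({x | Q n x i} ∩ ⋂ m, ⋂ (_ : m < n), ⋂ j, {x | Q m x j}ᶜ)) := by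
        refine hIopen.baireMeasurableSet.compl.inter (BaireMeasurableSet.iUnion fun n => ?_)
        refine (hQo n i).baireMeasurableSet.inter (BaireMeasurableSet.iInter fun m => ?_)
        exact BaireMeasurableSet.iInter fun _ => BaireMeasurableSet.iInter fun j =>
          (hQo m j).baireMeasurableSet.compl
      refine hB.congr (eventuallyEq_set.2 ?_)
      filter_upwards [hcov] with x hx
      constructor
      · rintro ⟨hI, hx⟩
        simp only [mem_iUnion, mem_inter_iff, mem_iInter] at hx
        obtain ⟨n, hn, hm⟩ := hx
        exact hcolQ x hI n i hn hm
      · intro h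
        have hI : ¬ I x := fun hI => emb_ne i ((show col x = emb i from h).symm.trans (hcolI x hI))
        refine ⟨hI, ?_⟩
        have hQ : ∃ n i, Q n x i := hx
        obtain ⟨j, hj⟩ := Nat.find_spec hQ
        have hmin : ∀ m < Nat.find hQ, ∀ j, ¬ Q m x j :=
          fun m hm j hj => Nat.find_min hQ hm ⟨j, hj⟩
        have := hcolQ x hI _ j hj hmin
        have hij : i = j := emb_inj ((show col x = emb i from h).symm.trans this)
        subst hij
        simp only [mem_iUnion, mem_inter_iff, mem_iInter]
        exact ⟨_, hj, hmin⟩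
    intro i
    fin_cases i
    · exact hi false
    · exact hi true
    · exact h2
  · -- the coloring is proper
    have hsymm : ∀ s ∈ S, s⁻¹ ∈ S := hS.2.1
    have Istep : ∀ (x y : FreePart G), ∀ s ∈ S, (y : G → Bool) = shiftMap s x → I x → ¬ I y := by
      rintro x y s hs hxy ⟨n, g, hg, hgx⟩ ⟨m, h, hh, hhy⟩
      rcases lt_trichotomy m n with hmn | rfl | hmn
      · refine hcomp m n hmn g s h hg hs hh _ hhy _ hgx ?_
        rw [shift_mul, shift_inv_right, shift_inv_right, hxy]
      · have e : s * g = h := by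
          refine (hp m).1.2.2 (s * g) h _ _ ?_ ?_ hgx hhy ?_
          · have := ls s hs g; omega
          · omega
          · rw [shift_mul, shift_inv_right, shift_inv_right, hxy]
        have h1 := lpar g h (by omega)
        rw [← e, hpar s hs] at h1
        cases h2 : par g <;> simp [h2] at h1
      · refine hcomp n m hmn h s⁻¹ g hh (hsymm s hs) hg _ hgx _ hhy ?_
        rw [shift_mul, shift_inv_right, shift_inv_right, hxy, shift_inv_left]
    have Qstep : ∀ (x y : FreePart G), ∀ s ∈ S, (y : G → Bool) = shiftMap s x → ¬ I y →
        ∀ n i, Q n x i → Q n y (!i) := by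
      rintro x y s hs hxy hI n i ⟨g, hg, hgx, rfl⟩
      have hmem : shiftMap (s * g)⁻¹ y ∈ (p n).1 := by
        rw [mul_inv_rev, shift_mul, hxy, shift_inv_left]; exact hgx
      refine ⟨s * g, ?_, hmem, hpar s hs g⟩
      by_contra hlt
      have := ls s hs g
      exact hI ⟨n, s * g, by omega, hmem⟩
    rintro x y ⟨-, s, hs, hxy⟩ heq
    have hyx : (x : G → Bool) = shiftMap s⁻¹ y := by rw [hxy, shift_inv_left]
    have noI : ∀ z w : FreePart G, I z → ¬ I w → col z = col w → False := by
      intro z w hz hw h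
      rw [hcolI z hz] at h
      by_cases hQ : ∃ n i, Q n w i
      · obtain ⟨i, hi⟩ := Nat.find_spec hQ
        have := hcolQ w hw _ i hi (fun m hm j hj => Nat.find_min hQ hm ⟨j, hj⟩)
        exact emb_ne i (this.symm.trans h.symm)
      · push Not at hQ
        exact emb_ne _ ((hcolZ w hw hQ).symm.trans h.symm)
    by_cases hIx : I x
    · exact noI x y hIx (Istep x y s hs hxy hIx) heq
    by_cases hIy : I y
    · exact noI y x hIy hIx heq.symm
    by_cases hQ : ∃ n i, Q n x i
    · obtain ⟨i, hi⟩ := Nat.find_spec hQ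
      have hmin : ∀ m < Nat.find hQ, ∀ j, ¬ Q m x j :=
        fun m hm j hj => Nat.find_min hQ hm ⟨j, hj⟩
      have e1 := hcolQ x hIx _ i hi hmin
      have e2 := hcolQ y hIy _ (!i) (Qstep x y s hs hxy hIy _ _ hi)
        (fun m hm j hj => hmin m hm _ (Qstep y x s⁻¹ (hsymm s hs) hyx hIx _ _ hj))
      have := emb_inj (e1.symm.trans (heq.trans e2))
      cases i <;> simp at this
    · push Not at hQ
      have e1 := hcolZ x hIx hQ
      have e2 := hcolZ y hIy
        (fun m j hj => hQ m _ (Qstep y x s⁻¹ (hsymm s hs) hyx hIx _ _ hj))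
      have := emb_inj (e1.symm.trans (heq.trans e2))
      rw [hf x y s hs hxy] at this
      cases h : f x <;> simp [h] at this

end ShiftBaire

/-- Let `(G, S)` be an infinite marked group whose Cayley graph is
bipartite. Then the Baire measurable chromatic number of the shift graph of `(G, S)`
equals `3`: there is a Baire measurable `3`-coloring of the shift graph, but no Baire
measurable `2`-coloring. -/
theorem baireChromatic_shift_of_bipartite {G : Type*} [Group G] [Infinite G]
    (S : Set G) (hS : IsMarkedGroup S)
    (hbip : ∃ c : G → Fin 2, ∀ g h, CayleyAdj S g h → c g ≠ c h) :
    baireChromatic (ShiftAdj S) = 3 ∧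
    HasBaireColoring (ShiftAdj S) 3 ∧ ¬ HasBaireColoring (ShiftAdj S) 2 := by
  classical
  obtain ⟨c, hc⟩ := hbip
  let par : G → Bool := fun g => decide (c g ≠ c 1)
  have h1 : par 1 = false := by simp [par]
  have hpar : ∀ s ∈ S, ∀ g, par (s * g) = !par g := by
    intro s hs g
    have hne : c g ≠ c (s * g) := hc g (s * g) ⟨fun e => hS.2.2.1 (by
      have : s = 1 := by simpa using e
      exact this ▸ hs), s, hs, rfl⟩
    have : (c (s * g) ≠ c 1) ↔ ¬ (c g ≠ c 1) := by omega
    change decide (c (s * g) ≠ c 1) = !decide (c g ≠ c 1)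
    rw [← decide_not]
    exact decide_eq_decide.2 this
  obtain ⟨l, -, -, hl, -⟩ := ShiftBaire.exists_len hS par hpar
  have hcount : Countable G := by
    rw [← Set.countable_univ_iff]
    refine (Set.countable_iUnion fun n => (hl n).countable).mono ?_
    intro g _
    exact Set.mem_iUnion.2 ⟨l g, le_refl (l g)⟩
  have h3 := ShiftBaire.three hS par hpar
  have h2 := ShiftBaire.no_two hS par h1 hpar
  refine ⟨?_, h3, h2⟩
  apply le_antisymm (Nat.sInf_le h3)
  refine le_csInf ⟨3, h3⟩ fun n hn => ?_
  by_contra hlt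
  apply h2
  obtain ⟨d, hdm, hd⟩ := hn
  have hle : n ≤ 2 := by omega
  refine ⟨fun x => Fin.castLE hle (d x), fun i => ?_, fun x y h e => hd x y h ?_⟩
  · by_cases hi : i.1 < n
    · convert hdm ⟨i.1, hi⟩ using 1
      ext x
      simp [Fin.ext_iff]
    · convert isOpen_empty.baireMeasurableSet using 1
      ext x
      simp only [Set.mem_preimage, Set.mem_singleton_iff, Fin.ext_iff, Fin.val_castLE,
        Set.mem_empty_iff_false, iff_false]
      have := (d x).2
      omega
  · exact Fin.castLE_injective hle e
end
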